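/- Let λ, μ, ν be partitions with at most k parts such that |ν| = |λ| + |μ|, let σ, τ be permutations of {1,…,k}, and set β = σ(λ) + τ(μ) − ν and γ = σ(δ) + τ(δ) − 2δ, where δ = (1/2)(k−1, k−3, …, −(k−1)) and permutations act on vectors by permuting coordinates. Let r(t) = tβ + γ. Then there exists an integer N such that K(r(t)) agrees with a non-zero polynomial in t for all integers t ≥ N if and only if for every i = 1,…,k, either β_1 + ⋯ + β_i > 0, or both β_1 + ⋯ + β_i = 0 and γ_1 + ⋯ + γ_i ≥ 0. -/

import Mathlib

/-!
Partitions with at most k parts are encoded as antitone functions `Fin k → ℕ`.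
-/

/-- The Kostant partition function for the root system of type `A_{k-1}`: `kostant k v` is
the number of ways to write `v` as a nonnegative integer combination of the positive roots
`e_i - e_j`, `i < j` (and it is `0` if `v` is not an integer vector).  A combination is
recorded as a matrix `b` of nonnegative integers supported on pairs `(i, j)` with `i < j`;
the coordinate `i` of `Σ_{i<j} b_{ij} (e_i - e_j)` is `Σ_j b_{ij} - Σ_j b_{ji}`. -/
noncomputable def kostant (k : ℕ) (v : Fin k → ℚ) : ℕ :=
  Nat.card {b : Fin k × Fin k → ℕ //
    (∀ p : Fin k × Fin k, ¬ p.1 < p.2 → b p = 0) ∧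
    ∀ i : Fin k, (∑ j : Fin k, (b (i, j) : ℚ)) - (∑ j : Fin k, (b (j, i) : ℚ)) = v i}

/-- The half-sum of positive roots `δ = (1/2)(k-1, k-3, …, -(k-3), -(k-1))`. -/
noncomputable def halfδ (k : ℕ) : Fin k → ℚ := fun i => ((k : ℚ) - 1) / 2 - (i : ℕ)


/-- `f` agrees with a polynomial at all sufficiently large integers. -/
def EventuallyPolynomial (f : ℤ → ℚ) : Prop :=
  ∃ (N : ℤ) (p : Polynomial ℚ), ∀ t : ℤ, N ≤ t → f t = p.eval (t : ℚ)

namespace EventuallyPolynomial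

theorem const (c : ℚ) : EventuallyPolynomial fun _ => c :=
  ⟨0, Polynomial.C c, fun _ _ => by simp⟩

theorem add {f g : ℤ → ℚ} (hf : EventuallyPolynomial f) (hg : EventuallyPolynomial g) :
    EventuallyPolynomial fun t => f t + g t := by
  obtain ⟨N, p, hp⟩ := hf
  obtain ⟨M, q, hq⟩ := hg
  refine ⟨max N M, p + q, fun t ht => ?_⟩
  simp [hp t ((le_max_left _ _).trans ht), hq t ((le_max_right _ _).trans ht)]

theorem neg {f : ℤ → ℚ} (hf : EventuallyPolynomial f) :
    EventuallyPolynomial fun t => -f t := by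
  obtain ⟨N, p, hp⟩ := hf
  exact ⟨N, -p, fun t ht => by simp [hp t ht]⟩

end EventuallyPolynomial

theorem Polynomial.exists_eval_add_one_sub_eval (p : Polynomial ℚ) :
    ∃ q : Polynomial ℚ, ∀ x : ℚ, q.eval (x + 1) - q.eval x = p.eval x := by
  induction p using Polynomial.induction_on' with
  | add p₁ p₂ h₁ h₂ =>
    obtain ⟨q₁, h₁⟩ := h₁
    obtain ⟨q₂, h₂⟩ := h₂
    refine ⟨q₁ + q₂, fun x => ?_⟩
    simp only [Polynomial.eval_add, ← h₁, ← h₂]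
    ring
  | monomial n a =>
    refine ⟨Polynomial.C (a / (n + 1)) * Polynomial.bernoulli (n + 1), fun x => ?_⟩
    have h := Polynomial.bernoulli_eval_one_add (n + 1) x
    have hn : (n : ℚ) + 1 ≠ 0 := by positivity
    rw [add_comm x 1]
    simp only [Polynomial.eval_mul, Polynomial.eval_C, h, Polynomial.eval_monomial]
    push_cast [Nat.add_sub_cancel]
    field_simp
    ring

/-- A function with eventually polynomial first difference is eventually polynomial. -/
theorem EventuallyPolynomial.of_difference {f : ℤ → ℚ}
    (h : EventuallyPolynomial fun t => f (t + 1) - f t) : EventuallyPolynomial f := by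
  obtain ⟨N, p, hp⟩ := h
  obtain ⟨q, hq⟩ := p.exists_eval_add_one_sub_eval
  refine ⟨N, q + Polynomial.C (f N - q.eval (N : ℚ)), fun t ht => ?_⟩
  induction t, ht using Int.leInduction with
  | base => simp
  | succ t ht ih =>
    have h₁ := hp t ht
    have h₂ := hq t
    simp only [Polynomial.eval_add, Polynomial.eval_C] at ih ⊢
    push_cast
    linarith

section VectorPartition

variable {ι G : Type*} [Fintype ι] [DecidableEq ι] [AddCommGroup G]

/-- The ways to write `v` as a nonnegative integer combination of the vectors `root p`,
`p ∈ S`. -/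
def vectorPartitions (root : ι → G) (S : Finset ι) (v : G) : Set (ι → ℕ) :=
  {b | (∀ p, p ∉ S → b p = 0) ∧ ∑ p, b p • root p = v}

theorem vectorPartitions_finite {root : ι → G} {S : Finset ι} (φ : G →+ ℤ)
    (hφ : ∀ p ∈ S, 0 < φ (root p)) (v : G) : (vectorPartitions root S v).Finite := by
  refine (Set.finite_Iic (fun _ : ι => (φ v).toNat)).subset fun b hb p => ?_
  obtain ⟨hS, hv⟩ := hb
  by_cases hp : p ∈ S
  · have hnn : ∀ q ∈ Finset.univ, 0 ≤ (b q : ℤ) * φ (root q) := fun q _ => by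
      by_cases hq : q ∈ S
      · exact mul_nonneg (by positivity) (hφ q hq).le
      · simp [hS q hq]
    have h := Finset.single_le_sum hnn (Finset.mem_univ p)
    have hsum : ∑ q, (b q : ℤ) * φ (root q) = φ v := by
      rw [← hv, map_sum]
      simp
    rw [hsum] at h
    have := hφ p hp
    have : (b p : ℤ) ≤ φ v := by nlinarith [Int.natCast_nonneg (b p)]
    show b p ≤ (φ v).toNat
    omega
  · simp [hS p hp]

theorem ncard_vectorPartitions {root : ι → G} {S : Finset ι} {p : ι} (hp : p ∈ S)
    (hfin : ∀ v, (vectorPartitions root S v).Finite) (v : G) :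
    (vectorPartitions root S v).ncard =
      (vectorPartitions root (S.erase p) v).ncard +
        (vectorPartitions root S (v - root p)).ncard := by
  have hsum : ∀ b : ι → ℕ, ∑ q, (b + Pi.single p 1 : ι → ℕ) q • root q =
      ∑ q, b q • root q + root p := fun b => by
    simp only [Pi.add_apply, add_smul, Finset.sum_add_distrib]
    congr 1
    rw [Finset.sum_eq_single p] <;> simp +contextual
  have hinj : Function.Injective fun b : ι → ℕ => b + Pi.single p 1 :=
    fun a b h => add_right_cancel h
  have hunion : vectorPartitions root S v = vectorPartitions root (S.erase p) v ∪
      (fun b : ι → ℕ => b + Pi.single p 1) '' vectorPartitions root S (v - root p) := by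
    ext b
    constructor
    · rintro ⟨hS, hv⟩
      by_cases hb : b p = 0
      · left
        refine ⟨fun q hq => ?_, hv⟩
        by_cases hqp : q = p
        · rw [hqp, hb]
        · exact hS q fun h => hq (Finset.mem_erase.2 ⟨hqp, h⟩)
      · right
        have hle : b - Pi.single p 1 + Pi.single p 1 = b := by
          ext q
          by_cases hqp : q = p
          · subst hqp
            simp only [Pi.add_apply, Pi.sub_apply, Pi.single_eq_same]
            omega
          · simp [hqp]
        refine ⟨b - Pi.single p 1, ⟨fun q hq => by simp [hS q hq], ?_⟩, hle⟩
        rw [eq_sub_iff_add_eq, ← hsum, hle, hv]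
    · rintro (⟨hS, hv⟩ | ⟨b, ⟨hS, hv⟩, rfl⟩)
      · exact ⟨fun q hq => hS q fun h => hq (Finset.mem_of_mem_erase h), hv⟩
      · refine ⟨fun q hq => ?_, ?_⟩
        · have : q ≠ p := fun h => hq (h ▸ hp)
          simp [hS q hq, this]
        · exact (hsum b).trans (by rw [hv, sub_add_cancel])
  have hfin' : (vectorPartitions root (S.erase p) v).Finite :=
    (hfin v).subset (hunion ▸ Set.subset_union_left)
  rw [hunion, Set.ncard_union_eq _ hfin' ((hfin _).image _), Set.ncard_image_of_injective _ hinj]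
  rw [Set.disjoint_left]
  rintro _ ⟨hS, -⟩ ⟨b, -, rfl⟩
  simpa using hS p (Finset.notMem_erase p S)

/-- If every subset of the vectors spans a subgroup with torsion-free quotient, then the
vector partition function is eventually polynomial along every arithmetic progression. -/
theorem eventuallyPolynomial_ncard_vectorPartitions {root : ι → G} (S : Finset ι)
    (htf : ∀ (T : Finset ι) (n : ℤ) (v : G), n ≠ 0 →
      n • v ∈ AddSubgroup.closure (root '' T) → v ∈ AddSubgroup.closure (root '' T))
    (φ : G →+ ℤ) (hφ : ∀ p ∈ S, 0 < φ (root p)) (β γ : G) :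
    EventuallyPolynomial fun t => ((vectorPartitions root S (t • β + γ)).ncard : ℚ) := by
  induction S using Finset.strongInduction generalizing γ with
  | H S ih =>
  by_cases hβ : β ∈ AddSubgroup.closure (root '' S)
  · have hstep : ∀ d ∈ AddSubgroup.closure (root '' S), ∀ γ, EventuallyPolynomial fun t =>
        ((vectorPartitions root S (t • β + (γ + d))).ncard : ℚ) -
          (vectorPartitions root S (t • β + γ)).ncard := by
      intro d hd
      induction hd using AddSubgroup.closure_induction with
      | mem x hx =>
        obtain ⟨p, hp, rfl⟩ := hx
        intro γ
        have h := ih _ (Finset.erase_ssubset hp)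
          (fun q hq => hφ q (Finset.mem_of_mem_erase hq)) (γ + root p)
        refine cast (congrArg EventuallyPolynomial (funext fun t => ?_)) h
        rw [ncard_vectorPartitions hp (vectorPartitions_finite φ hφ) (t • β + (γ + root p)),
          show t • β + (γ + root p) - root p = t • β + γ by abel]
        push_cast
        ring
      | zero => simpa using EventuallyPolynomial.const 0
      | add x y _ _ hx hy =>
        intro γ
        refine cast (congrArg EventuallyPolynomial (funext fun t => ?_))
          ((hx γ).add (hy (γ + x)))
        simp only [← add_assoc]
        ring
      | neg x _ hx =>
        intro γ
        refine cast (congrArg EventuallyPolynomial (funext fun t => ?_)) (hx (γ + -x)).neg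
        rw [neg_add_cancel_right]
        ring
    refine EventuallyPolynomial.of_difference
      (cast (congrArg EventuallyPolynomial (funext fun t => ?_)) (hstep β hβ γ))
    rw [show t • β + (γ + β) = (t + 1) • β + γ by rw [add_smul, one_smul]; abel]
  · have hempty : ∀ t : ℤ, t • β + γ ∉ AddSubgroup.closure (root '' S) →
        (vectorPartitions root S (t • β + γ)).ncard = 0 := by
      intro t ht
      suffices vectorPartitions root S (t • β + γ) = ∅ by simp [this]
      refine Set.eq_empty_of_forall_notMem ?_
      rintro b ⟨hS, hv⟩
      refine ht (hv ▸ AddSubgroup.sum_mem _ fun p _ => ?_)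
      by_cases hp : p ∈ S
      · exact AddSubgroup.nsmul_mem _
          (AddSubgroup.subset_closure (Set.mem_image_of_mem root (Finset.mem_coe.2 hp))) _
      · simp [hS p hp]
    by_cases hex : ∃ s : ℤ, s • β + γ ∈ AddSubgroup.closure (root '' S)
    · obtain ⟨s, hs⟩ := hex
      refine ⟨s + 1, 0, fun t ht => ?_⟩
      beta_reduce
      rw [hempty t]
      · simp
      · intro h
        refine hβ (htf S (t - s) β (by omega) ?_)
        have := AddSubgroup.sub_mem _ h hs
        rwa [add_sub_add_right_eq_sub, ← sub_smul] at this
    · push Not at hex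
      exact ⟨0, 0, fun t _ => by simp [hempty t (hex t)]⟩

end VectorPartition

/-- The root `e_i - e_j` of type `A`. -/
def rootA {k : ℕ} (p : Fin k × Fin k) : Fin k → ℤ := Pi.single p.1 1 - Pi.single p.2 1

/-- The quotient of the root lattice by the span of any set of roots of type `A` is
torsion-free. -/
theorem mem_closure_rootA_of_smul_mem {k : ℕ} (T : Set (Fin k × Fin k)) (n : ℤ)
    (v : Fin k → ℤ) (hn : n ≠ 0) (h : n • v ∈ AddSubgroup.closure (rootA '' T)) :
    v ∈ AddSubgroup.closure (rootA '' T) := by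
  set M := AddSubgroup.closure (rootA '' T)
  let r : Setoid (Fin k) :=
    { r := fun i j => rootA (i, j) ∈ M
      iseqv :=
        { refl := fun i => by simp [rootA]
          symm := fun {i j} h => by simpa [rootA] using M.neg_mem h
          trans := fun {i j l} h₁ h₂ => by simpa [rootA] using M.add_mem h₁ h₂ } }
  let c : Fin k → Fin k := fun i => (Quotient.mk r i).out
  have hc : ∀ i, rootA (i, c i) ∈ M := fun i => r.symm (Quotient.mk_out (s := r) i)
  let π : (Fin k → ℤ) →+ (Fin k → ℤ) :=
    { toFun := fun w => ∑ i, w i • Pi.single (c i) 1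
      map_zero' := by simp
      map_add' := fun x y => by simp only [Pi.add_apply, add_smul, Finset.sum_add_distrib] }
  have hπs : ∀ i, π (Pi.single i 1) = Pi.single (c i) 1 := fun i => by
    show ∑ j, (Pi.single i 1 : Fin k → ℤ) j • (Pi.single (c j) 1 : Fin k → ℤ) = _
    rw [Finset.sum_eq_single i] <;> simp +contextual
  have hπM : ∀ w ∈ M, π w = 0 := by
    intro w hw
    induction hw using AddSubgroup.closure_induction with
    | mem x hx =>
      obtain ⟨p, hp, rfl⟩ := hx
      have : c p.1 = c p.2 := congrArg Quotient.out
        (Quotient.sound (s := r) (AddSubgroup.subset_closure ⟨p, hp, rfl⟩))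
      rw [rootA, map_sub, hπs, hπs, this, sub_self]
    | zero => exact map_zero π
    | add x y _ _ hx hy => rw [map_add, hx, hy, add_zero]
    | neg x _ hx => rw [map_neg, hx, neg_zero]
  have hsub : v - π v ∈ M := by
    have : v - π v = ∑ i, v i • rootA (i, c i) := by
      simp only [rootA, smul_sub, Finset.sum_sub_distrib]
      congr 1
      ext j
      simp [Finset.sum_apply, Pi.single_apply]
    rw [this]
    exact M.sum_mem fun i _ => M.zsmul_mem (hc i) _
  have hπv : π v = 0 := by
    have h0 := hπM _ h
    rw [map_zsmul] at h0
    exact (smul_eq_zero.1 h0).resolve_left hn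
  simpa [hπv] using hsub

/-- The index set of the positive roots. -/
def posPairs (k : ℕ) : Finset (Fin k × Fin k) := Finset.univ.filter fun p => p.1 < p.2

theorem sum_smul_rootA_apply {k : ℕ} (b : Fin k × Fin k → ℕ) (i : Fin k) :
    (∑ p, b p • rootA p) i = ∑ j, (b (i, j) : ℤ) - ∑ j, (b (j, i) : ℤ) := by
  simp only [rootA, smul_sub, Finset.sum_sub_distrib, Pi.sub_apply, Finset.sum_apply]
  congr 1
  · rw [Fintype.sum_prod_type, Finset.sum_eq_single i] <;>
      simp +contextual [eq_comm]
  · rw [Fintype.sum_prod_type_right, Finset.sum_eq_single i] <;>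
      simp +contextual [eq_comm]

theorem kostant_intCast {k : ℕ} (v : Fin k → ℤ) :
    kostant k (fun i => (v i : ℚ)) = (vectorPartitions rootA (posPairs k) v).ncard := by
  rw [← Nat.card_coe_set_eq, kostant]
  refine Nat.card_congr (Equiv.subtypeEquivRight fun b => ?_)
  refine and_congr (by simp [posPairs]) ?_
  rw [funext_iff]
  refine forall_congr' fun i => ?_
  rw [sum_smul_rootA_apply]
  exact_mod_cast Iff.rfl

/-- A functional that is positive on the positive roots. -/
def coheight (k : ℕ) : (Fin k → ℤ) →+ ℤ where
  toFun v := ∑ i : Fin k, -((i : ℕ) : ℤ) * v i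
  map_zero' := by simp
  map_add' x y := by simp only [Pi.add_apply, mul_add, Finset.sum_add_distrib]

theorem coheight_rootA_pos {k : ℕ} (p : Fin k × Fin k) (hp : p ∈ posPairs k) :
    0 < coheight k (rootA p) := by
  have h : p.1 < p.2 := by simpa [posPairs] using hp
  have : coheight k (rootA p) = ((p.2 : ℕ) : ℤ) - ((p.1 : ℕ) : ℤ) := by
    show ∑ i : Fin k, -((i : ℕ) : ℤ) * (rootA p) i = _
    simp [rootA, mul_sub, Pi.single_apply]
    ring
  rw [this]
  have : (p.1 : ℕ) < p.2 := h
  omega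

theorem vectorPartitions_posPairs_finite {k : ℕ} (v : Fin k → ℤ) :
    (vectorPartitions rootA (posPairs k) v).Finite :=
  vectorPartitions_finite (coheight k) coheight_rootA_pos v

/-- The partial sum `v_1 + ⋯ + v_i`. -/
def partialSum {k : ℕ} {R : Type*} [AddCommMonoid R] (v : Fin k → R) (i : Fin k) : R :=
  ∑ j ∈ Finset.univ.filter (fun j : Fin k => j ≤ i), v j

theorem partialSum_nonneg_of_mem {k : ℕ} {v : Fin k → ℤ} {b : Fin k × Fin k → ℕ}
    (hb : b ∈ vectorPartitions rootA (posPairs k) v) (i : Fin k) : 0 ≤ partialSum v i := by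
  obtain ⟨hS, rfl⟩ := hb
  simp only [partialSum, Finset.sum_apply]
  rw [Finset.sum_comm]
  refine Finset.sum_nonneg fun p _ => ?_
  by_cases hp : p ∈ posPairs k
  · have h : p.1 < p.2 := by simpa [posPairs] using hp
    simp only [Pi.smul_apply, ← Finset.smul_sum]
    refine nsmul_nonneg ?_ _
    simp only [rootA, Pi.sub_apply, Finset.sum_sub_distrib, Finset.sum_pi_single',
      Finset.mem_filter, Finset.mem_univ, true_and]
    split_ifs <;> omega
  · simp [hS p hp]

theorem vectorPartitions_nonempty {k : ℕ} {v : Fin k → ℤ} (h0 : ∑ i, v i = 0)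
    (hv : ∀ i, 0 ≤ partialSum v i) : (vectorPartitions rootA (posPairs k) v).Nonempty := by
  refine ⟨fun p => if (p.1 : ℕ) + 1 = p.2 then (partialSum v p.1).toNat else 0,
    fun p hp => ?_, funext fun i => ?_⟩
  · refine if_neg fun h => hp ?_
    simp only [posPairs, Finset.mem_filter, Finset.mem_univ, true_and, Fin.lt_def]
    omega
  · rw [sum_smul_rootA_apply]
    have hout : ∑ j : Fin k,
        ((if (i : ℕ) + 1 = j then (partialSum v i).toNat else 0 : ℕ) : ℤ) = partialSum v i := by
      by_cases hi : (i : ℕ) + 1 < k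
      · rw [Finset.sum_eq_single ⟨i + 1, hi⟩]
        · simp [hv i]
        · intro j _ hj
          rw [if_neg fun h => hj (Fin.ext h.symm), Nat.cast_zero]
        · simp
      · have hlast : partialSum v i = 0 := by
          rw [partialSum, Finset.filter_true_of_mem, h0]
          intro j _
          rw [Fin.le_def]
          omega
        simp [hlast]
    have hin : ∑ j : Fin k,
        ((if (j : ℕ) + 1 = i then (partialSum v j).toNat else 0 : ℕ) : ℤ) =
          partialSum v i - v i := by
      by_cases hi : (i : ℕ) = 0
      · rw [Finset.sum_eq_zero fun j _ => by rw [if_neg (by omega), Nat.cast_zero], partialSum,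
          show Finset.univ.filter (fun j : Fin k => j ≤ i) = {i} by
            ext j
            simp only [Finset.mem_filter, Finset.mem_univ, true_and, Finset.mem_singleton,
              Fin.le_def, Fin.ext_iff]
            omega]
        simp
      · have hi' : (i : ℕ) - 1 < k := by omega
        rw [Finset.sum_eq_single ⟨i - 1, hi'⟩]
        · rw [if_pos (show (i : ℕ) - 1 + 1 = i by omega), Int.toNat_of_nonneg (hv _),
            eq_sub_iff_add_eq, partialSum, partialSum,
            show Finset.univ.filter (fun j : Fin k => j ≤ i) =
              insert i (Finset.univ.filter fun j : Fin k => j ≤ ⟨i - 1, hi'⟩) by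
              ext j
              simp only [Finset.mem_filter, Finset.mem_univ, true_and, Finset.mem_insert,
                Fin.le_def, Fin.ext_iff]
              omega,
            Finset.sum_insert, add_comm]
          simp only [Finset.mem_filter, Finset.mem_univ, true_and, Fin.le_def]
          omega
        · intro j _ hj
          rw [if_neg fun h => hj (Fin.ext (by simp only; omega)), Nat.cast_zero]
        · simp
    simp only [hout, hin]
    ring

theorem kostant_intCast_pos_iff {k : ℕ} {v : Fin k → ℤ} (h0 : ∑ i, v i = 0) :
    0 < kostant k (fun i => (v i : ℚ)) ↔ ∀ i, 0 ≤ partialSum v i := by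
  rw [kostant_intCast, Set.ncard_pos (vectorPartitions_posPairs_finite v)]
  exact ⟨fun ⟨_, hb⟩ => partialSum_nonneg_of_mem hb, vectorPartitions_nonempty h0⟩

theorem partialSum_smul_add {k : ℕ} (β γ : Fin k → ℤ) (t : ℤ) (i : Fin k) :
    partialSum (t • β + γ) i = t * partialSum β i + partialSum γ i := by
  simp [partialSum, Finset.sum_add_distrib, Finset.mul_sum]

theorem eventuallyPolynomial_kostant {k : ℕ} (β γ : Fin k → ℤ) :
    EventuallyPolynomial fun t => (kostant k (fun i => ((t • β + γ) i : ℚ)) : ℚ) := by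
  simp only [kostant_intCast]
  exact eventuallyPolynomial_ncard_vectorPartitions (posPairs k)
    (fun T => mem_closure_rootA_of_smul_mem (T : Set (Fin k × Fin k))) (coheight k)
    coheight_rootA_pos β γ

/-- Along an arithmetic progression of integer vectors with coordinate sum zero, the Kostant
partition function is eventually a nonzero polynomial exactly when the partial sums are
eventually nonnegative. -/
theorem kostant_eq_polynomial_iff {k : ℕ} {β γ : Fin k → ℤ} (hβ : ∑ i, β i = 0)
    (hγ : ∑ i, γ i = 0) :
    (∃ (N : ℤ) (p : Polynomial ℚ), p ≠ 0 ∧ ∀ t : ℤ, N ≤ t →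
        (kostant k (fun i => ((t • β + γ) i : ℚ)) : ℚ) = p.eval (t : ℚ)) ↔
      ∀ i, 0 < partialSum β i ∨ (partialSum β i = 0 ∧ 0 ≤ partialSum γ i) := by
  have h0 : ∀ t : ℤ, ∑ i, (t • β + γ) i = 0 := fun t => by
    simp [Finset.sum_add_distrib, ← Finset.mul_sum, hβ, hγ]
  constructor
  · rintro ⟨N, p, hp, hK⟩ i
    have hlarge : ∀ M : ℤ, ∃ t, M ≤ t ∧ 0 ≤ t * partialSum β i + partialSum γ i := by
      intro M
      have hfin : {t : ℤ | p.eval (t : ℚ) = 0}.Finite :=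
        (Polynomial.finite_setOfPred_isRoot hp).preimage Int.cast_injective.injOn
      obtain ⟨t, ht, hroot⟩ := (Set.Ici_infinite (max M N)).exists_notMem_finite hfin
      refine ⟨t, (le_max_left _ _).trans ht, ?_⟩
      rw [← partialSum_smul_add]
      refine (kostant_intCast_pos_iff (h0 t)).1 (Nat.pos_of_ne_zero fun hz => hroot ?_) i
      have := hK t ((le_max_right _ _).trans ht)
      rw [hz] at this
      simpa using this.symm
    obtain ⟨t, ht, h⟩ := hlarge (|partialSum γ i| + 1)
    have habs := le_abs_self (partialSum γ i)
    have habs' := abs_nonneg (partialSum γ i)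
    rcases lt_trichotomy (partialSum β i) 0 with hneg | hzero | hpos
    · nlinarith
    · exact Or.inr ⟨hzero, by simpa [hzero] using h⟩
    · exact Or.inl hpos
  · intro h
    obtain ⟨N, p, hK⟩ := eventuallyPolynomial_kostant β γ
    refine ⟨N, p, ?_, hK⟩
    rintro rfl
    set M := ∑ i, |partialSum γ i|
    have hM : ∀ i, |partialSum γ i| ≤ M := fun i =>
      Finset.single_le_sum (f := fun i => |partialSum γ i|) (fun _ _ => abs_nonneg _)
        (Finset.mem_univ i)
    have hpos := (kostant_intCast_pos_iff (h0 (max N M))).2 fun i => by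
      rw [partialSum_smul_add]
      have h₁ := hM i
      have h₂ := neg_abs_le (partialSum γ i)
      have h₃ := le_max_right N M
      have h₄ := abs_nonneg (partialSum γ i)
      rcases h i with hb | ⟨hb, hc⟩
      · nlinarith
      · rw [hb]
        omega
    have := hK (max N M) (le_max_left _ _)
    rw [Polynomial.eval_zero, Nat.cast_eq_zero] at this
    exact hpos.ne' this

/-- Let `β = σ(λ) + τ(μ) − ν` and `γ = σ(δ) + τ(δ) − 2δ`, and `r(t) = tβ + γ`.  There is
an integer `N` such that `K(r(t))` agrees with a non-zero polynomial in `t` for all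
integers `t ≥ N` if and only if for every `i = 1, …, k`, either `β_1 + ⋯ + β_i > 0`, or
both `β_1 + ⋯ + β_i = 0` and `γ_1 + ⋯ + γ_i ≥ 0`. -/
theorem stmt5 (k : ℕ) (hk : 0 < k)
    (lam mu ν : Fin k → ℕ) (hlam : Antitone lam) (hmu : Antitone mu) (hν : Antitone ν)
    (hsum : ∑ i, ν i = ∑ i, lam i + ∑ i, mu i)
    (σ τ : Equiv.Perm (Fin k))
    (β γ : Fin k → ℚ)
    (hβ : β = fun i => (lam (σ i) : ℚ) + (mu (τ i) : ℚ) - (ν i : ℚ))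
    (hγ : γ = fun i => halfδ k (σ i) + halfδ k (τ i) - 2 * halfδ k i) :
    (∃ (N : ℤ) (p : Polynomial ℚ), p ≠ 0 ∧
        ∀ t : ℤ, N ≤ t →
          (kostant k (fun i => (t : ℚ) * β i + γ i) : ℚ) = p.eval (t : ℚ)) ↔
      ∀ i : Fin k,
        (0 < ∑ j ∈ Finset.univ.filter (fun j : Fin k => j ≤ i), β j) ∨
        ((∑ j ∈ Finset.univ.filter (fun j : Fin k => j ≤ i), β j) = 0 ∧
          0 ≤ ∑ j ∈ Finset.univ.filter (fun j : Fin k => j ≤ i), γ j) := by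
  subst hβ hγ
  let B : Fin k → ℤ := fun i => (lam (σ i) : ℤ) + mu (τ i) - ν i
  let C : Fin k → ℤ := fun i => 2 * ((i : ℕ) : ℤ) - ((σ i : ℕ) : ℤ) - ((τ i : ℕ) : ℤ)
  have hB : ∀ i, (lam (σ i) : ℚ) + (mu (τ i) : ℚ) - (ν i : ℚ) = (B i : ℚ) := fun i => by
    simp [B]
  have hC : ∀ i, halfδ k (σ i) + halfδ k (τ i) - 2 * halfδ k i = (C i : ℚ) := fun i => by
    simp only [halfδ, C]
    push_cast
    ring
  have hB0 : ∑ i, B i = 0 := by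
    simp only [B, Finset.sum_add_distrib, Finset.sum_sub_distrib]
    rw [Equiv.sum_comp σ (fun i => (lam i : ℤ)), Equiv.sum_comp τ (fun i => (mu i : ℤ))]
    have : (∑ i, (ν i : ℤ)) = ∑ i, (lam i : ℤ) + ∑ i, (mu i : ℤ) := by exact_mod_cast hsum
    omega
  have hC0 : ∑ i, C i = 0 := by
    simp only [C, Finset.sum_sub_distrib, ← Finset.mul_sum]
    rw [Equiv.sum_comp σ (fun i => ((i : ℕ) : ℤ)), Equiv.sum_comp τ (fun i => ((i : ℕ) : ℤ))]
    ring
  have hmain := kostant_eq_polynomial_iff hB0 hC0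
  simp only [hB, hC]
  simp only [partialSum, Pi.add_apply, Pi.smul_apply, smul_eq_mul] at hmain
  exact_mod_cast hmain
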